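/- arXiv:2310.18561 — 2 statements merged into one kernel-verified Lean document; each statement's English description precedes it below -/
import Mathlib

section
/- Let p be a prime, n a positive integer, and for each integer j define the function μ_j : ℤ → ZMod p by μ_j(x) = the image modulo p of the generalized binomial coefficient C(x − j − 1, p^n − 1). Then for all integers j and j', one has (∀ x ∈ ℤ, μ_j(x) = μ_{j'}(x)) if and only if j ≡ j' (mod p^n). (Pointwise form of the statement: μ_{i,j}^{(n)} = μ_{i,j'}^{(n)} in the hyperalgebra if and only if j ≡ j' mod p^n.) -/
/-- The pointwise form of the idempotent `μ_{i,j}^{(n)} = binom(h_i − j − 1, p^n − 1)`: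
the image in `ZMod p` of the generalized binomial coefficient `C(x − j − 1, p^n − 1)`. -/
def muIdem (p n : ℕ) (j x : ℤ) : ZMod p :=
  ((Ring.choose (x - j - 1) (p ^ n - 1) : ℤ) : ZMod p)

/-- Modulo `p`, the function `y ↦ C(y, k)` is periodic with period `p ^ n` when `k < p ^ n`. -/
theorem choose_add_prime_pow_cast {p : ℕ} (hp : p.Prime) (n : ℕ) {k : ℕ} (hk : k < p ^ n)
    (y : ℤ) :
    ((Ring.choose (y + (p : ℤ) ^ n) k : ℤ) : ZMod p) = ((Ring.choose y k : ℤ) : ZMod p) := by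
  rw [Ring.add_choose_eq k (Commute.all _ _), Int.cast_sum,
    Finset.sum_eq_single_of_mem (k, 0) (by simp)]
  · simp
  · rintro ⟨a, b⟩ hab hne
    have hsum : a + b = k := by simpa using hab
    have hb : b ≠ 0 := by
      rintro rfl
      exact hne (by simpa using hsum)
    have hdvd : p ∣ (p ^ n).choose b := hp.dvd_choose_pow hb (by omega)
    have hzero : (((p ^ n).choose b : ℕ) : ZMod p) = 0 :=
      (ZMod.natCast_eq_zero_iff _ _).2 hdvd
    have hcast : Ring.choose ((p : ℤ) ^ n) b = ((p ^ n).choose b : ℕ) := by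
      rw [← Ring.choose_natCast]
      push_cast
      rfl
    simp [hcast, hzero]

theorem choose_cast_eq_of_modEq {p : ℕ} (hp : p.Prime) (n : ℕ) {k : ℕ} (hk : k < p ^ n)
    {y z : ℤ} (h : y ≡ z [ZMOD (p : ℤ) ^ n]) :
    ((Ring.choose y k : ℤ) : ZMod p) = ((Ring.choose z k : ℤ) : ZMod p) := by
  have hper : Function.Periodic (fun y : ℤ ↦ ((Ring.choose y k : ℤ) : ZMod p)) ((p : ℤ) ^ n) :=
    choose_add_prime_pow_cast hp n hk
  obtain ⟨c, hc⟩ := h.dvd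
  have hz : z = y + c * (p : ℤ) ^ n := by linarith
  rw [hz]
  exact (hper.int_mul c y).symm

/-- Modulo `p`, `C(y, p ^ n - 1)` is the indicator of the residue class of `-1` mod `p ^ n`. -/
theorem choose_prime_pow_sub_one_cast {p : ℕ} (hp : p.Prime) (n : ℕ) (y : ℤ) :
    ((Ring.choose y (p ^ n - 1) : ℤ) : ZMod p) =
      if y ≡ -1 [ZMOD (p : ℤ) ^ n] then 1 else 0 := by
  have hq : 0 < p ^ n := pow_pos hp.pos n
  have hk : p ^ n - 1 < p ^ n := by omega
  have hsub : ((p ^ n - 1 : ℕ) : ℤ) = (p : ℤ) ^ n - 1 := by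
    rw [Nat.cast_sub hq]
    simp
  have hlast : ((p ^ n - 1 : ℕ) : ℤ) ≡ -1 [ZMOD (p : ℤ) ^ n] :=
    (Int.modEq_iff_dvd.2 ⟨1, by rw [hsub]; ring⟩ : -1 ≡ _ [ZMOD (p : ℤ) ^ n]).symm
  split_ifs with h
  · rw [choose_cast_eq_of_modEq hp n hk (h.trans hlast.symm), Ring.choose_natCast]
    simp
  · have hpos : (0 : ℤ) < (p : ℤ) ^ n := by exact_mod_cast hq
    obtain ⟨m, hm⟩ := Int.eq_ofNat_of_zero_le (Int.emod_nonneg y hpos.ne')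
    have hym : y ≡ (m : ℤ) [ZMOD (p : ℤ) ^ n] := hm ▸ (Int.mod_modEq y _).symm
    have hlt : (m : ℤ) < (p : ℤ) ^ n := hm ▸ Int.emod_lt_of_pos y hpos
    have hne : m ≠ p ^ n - 1 := by
      rintro rfl
      exact h (hym.trans hlast)
    have hlt' : m < p ^ n - 1 := by
      have : m < p ^ n := by exact_mod_cast hlt
      omega
    rw [choose_cast_eq_of_modEq hp n hk hym, Ring.choose_natCast, Nat.choose_eq_zero_of_lt hlt']
    simp

/-- Pointwise form of: `μ_{i,j}^{(n)} = μ_{i,j'}^{(n)}` if and only if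
`j ≡ j' (mod p^n)`. -/
theorem muIdem_eq_iff_modEq (p : ℕ) (hp : p.Prime) (n : ℕ) (hn : 0 < n) (j j' : ℤ) :
    (∀ x : ℤ, muIdem p n j x = muIdem p n j' x) ↔ j ≡ j' [ZMOD ((p : ℤ) ^ n)] := by
  constructor
  · intro h
    have : Fact p.Prime := ⟨hp⟩
    have hj := h j
    simp only [muIdem, choose_prime_pow_sub_one_cast hp] at hj
    rw [if_pos (by simp)] at hj
    by_cases hc : j - j' - 1 ≡ -1 [ZMOD (p : ℤ) ^ n]
    · simpa [sub_add_cancel] using hc.add_right (j' + 1)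
    · simp [hc] at hj
  · intro h x
    have hk : p ^ n - 1 < p ^ n := Nat.sub_lt (pow_pos hp.pos n) one_pos
    exact choose_cast_eq_of_modEq hp n hk ((h.sub_left x).sub_right 1)
end

section
/- Let p be a prime, n a positive integer, j an integer, and t a natural number with t ≤ p^n − 1. Then for every integer x, the following identity holds in ZMod p: C(x, t) · C(x − j − 1, p^n − 1) = C(j, t) · C(x − j − 1, p^n − 1), where all generalized binomial coefficients are reduced modulo p. (Pointwise form of the statement: binom(h_i, t)·μ_{i,j}^{(n)} = binom(j, t)·μ_{i,j}^{(n)} in the hyperalgebra 𝒰_n^0 for t ∈ {0,…,p^n−1}.) -/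
/-- The absorption identity for generalized binomial coefficients. -/
theorem Int.natCast_mul_ringChoose (y : ℤ) {k : ℕ} (hk : 1 ≤ k) :
    (k : ℤ) * Ring.choose y k = y * Ring.choose (y - 1) (k - 1) := by
  simpa using Ring.choose_smul_choose y hk

theorem Int.prime_dvd_right_of_pow_dvd_mul {p n : ℕ} (hp : p.Prime) {a c : ℤ}
    (h : (p : ℤ) ^ n ∣ a * c) (ha : ¬ (p : ℤ) ^ n ∣ a) : (p : ℤ) ∣ c := by
  by_contra hc
  exact ha ((((Nat.prime_iff_prime_int.mp hp).coprime_iff_not_dvd.mpr hc).pow_left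
    (m := n)).dvd_of_dvd_mul_right h)

theorem Int.prime_dvd_ringChoose_of_pow_dvd {p n k : ℕ} (hp : p.Prime) {y : ℤ}
    (hy : (p : ℤ) ^ n ∣ y) (hk : 0 < k) (hkn : k < p ^ n) : (p : ℤ) ∣ Ring.choose y k := by
  refine Int.prime_dvd_right_of_pow_dvd_mul hp (n := n) (a := k) ?_ ?_
  · rw [Int.natCast_mul_ringChoose y hk]
    exact hy.mul_right _
  · exact_mod_cast Nat.not_dvd_of_pos_of_lt hk hkn

theorem Int.prime_dvd_ringChoose_sub_one_of_not_pow_dvd {p n : ℕ} (hp : p.Prime) {y : ℤ}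
    (hy : ¬ (p : ℤ) ^ n ∣ y) : (p : ℤ) ∣ Ring.choose (y - 1) (p ^ n - 1) := by
  refine Int.prime_dvd_right_of_pow_dvd_mul hp (n := n) (a := y) ?_ hy
  rw [← Int.natCast_mul_ringChoose y (Nat.one_le_pow n p hp.pos)]
  push_cast
  exact dvd_mul_right _ _

/-- For `t < p ^ n`, the coefficient `C(x, t)` modulo `p` depends only on `x` modulo `p ^ n`. -/
theorem ZMod.intCast_ringChoose_eq_of_pow_dvd_sub {p n t : ℕ} (hp : p.Prime) {x j : ℤ}
    (h : (p : ℤ) ^ n ∣ x - j) (ht : t < p ^ n) :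
    ((Ring.choose x t : ℤ) : ZMod p) = ((Ring.choose j t : ℤ) : ZMod p) := by
  rw [show x = j + (x - j) by ring, Ring.add_choose_eq t (Commute.all _ _), Int.cast_sum,
    Finset.sum_eq_single (t, 0)]
  · simp
  · rintro ⟨a, b⟩ hab hne
    rw [Finset.HasAntidiagonal.mem_antidiagonal] at hab
    have hb : 0 < b := Nat.pos_of_ne_zero fun hb => hne (by rw [Prod.mk.injEq]; lia)
    rw [ZMod.intCast_zmod_eq_zero_iff_dvd]
    exact (Int.prime_dvd_ringChoose_of_pow_dvd hp h hb (by lia)).mul_left _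
  · simp

/-- Pointwise form of: `binom(h_i, t)·μ_{i,j}^{(n)} = binom(j, t)·μ_{i,j}^{(n)}` in the
hyperalgebra `𝒰_n^0` for `t ∈ {0,…,p^n−1}`. -/
theorem ring_choose_mul_muIdem (p : ℕ) (hp : p.Prime) (n : ℕ) (hn : 0 < n)
    (j : ℤ) (t : ℕ) (ht : t ≤ p ^ n - 1) (x : ℤ) :
    ((Ring.choose x t : ℤ) : ZMod p) * muIdem p n j x =
      ((Ring.choose j t : ℤ) : ZMod p) * muIdem p n j x := by
  by_cases h : (p : ℤ) ^ n ∣ x - j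
  · rw [ZMod.intCast_ringChoose_eq_of_pow_dvd_sub hp h
      (Nat.lt_of_le_pred (pow_pos hp.pos n) ht)]
  · have hmu : muIdem p n j x = 0 :=
      (ZMod.intCast_zmod_eq_zero_iff_dvd _ p).mpr
        (Int.prime_dvd_ringChoose_sub_one_of_not_pow_dvd hp h)
    rw [hmu, mul_zero, mul_zero]
end
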